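/- For every integer n ≥ 0 and every t > 0, one has t·K_n(t)·I_n(t) ≤ t·K_{n+1}(t)·I_n(t) ≤ 1. -/

import Mathlib

open MeasureTheory Real intervalIntegral

/-- Modified Bessel function of the first kind of integer order `n`:
`I_n(t) = (1/π) ∫_0^π exp(t cos α) cos(n α) dα`. -/
noncomputable def besselI (n : ℤ) (t : ℝ) : ℝ :=
  (1 / Real.pi) * ∫ α in (0:ℝ)..Real.pi, Real.exp (t * Real.cos α) * Real.cos ((n : ℝ) * α)

/-- Modified Bessel function of the second kind of integer order `n`:
`K_n(t) = ∫_0^∞ exp(−t cosh α) cosh(n α) dα`. -/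
noncomputable def besselK (n : ℤ) (t : ℝ) : ℝ :=
  ∫ α in Set.Ioi (0:ℝ), Real.exp (-t * Real.cosh α) * Real.cosh ((n : ℝ) * α)

open Filter Topology Set

lemma bessel_exp_bound (t k α : ℝ) (ht : 0 < t) (hα : 0 ≤ α) :
    Real.exp (-t * Real.cosh α) * Real.exp (|k * α|) ≤
      Real.exp ((|k| + 1) ^ 2 / t) * Real.exp (-α) := by
  rw [← Real.exp_add, ← Real.exp_add, Real.exp_le_exp, abs_mul, abs_of_nonneg hα]
  have h1 : α ^ 2 / 4 ≤ Real.cosh α := by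
    have := Real.quadratic_le_exp_of_nonneg hα
    have := Real.exp_pos (-α)
    rw [Real.cosh_eq]; nlinarith
  have h2 : t * (α ^ 2 / 4) ≤ t * Real.cosh α := mul_le_mul_of_nonneg_left h1 ht.le
  have h3 : 0 ≤ (t * α / 2 - (|k| + 1)) ^ 2 / t := by positivity
  have h4 : (t * α / 2 - (|k| + 1)) ^ 2 / t
      = t * (α ^ 2 / 4) - (|k| + 1) * α + (|k| + 1) ^ 2 / t := by
    field_simp; ring
  linarith

lemma bessel_cosh_le (x : ℝ) : Real.cosh x ≤ Real.exp |x| := by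
  rw [Real.cosh_eq]
  have h1 := Real.exp_le_exp.2 (le_abs_self x)
  have h2 := Real.exp_le_exp.2 (neg_le_abs x)
  linarith

lemma bessel_abs_sinh_le (x : ℝ) : |Real.sinh x| ≤ Real.exp |x| := by
  rw [Real.sinh_eq, abs_le]
  have h1 := Real.exp_le_exp.2 (le_abs_self x)
  have h2 := Real.exp_le_exp.2 (neg_le_abs x)
  have := Real.exp_pos x
  have := Real.exp_pos (-x)
  constructor <;> linarith

lemma besselK_integrable (k t : ℝ) (ht : 0 < t) :
    IntegrableOn (fun α => Real.exp (-t * Real.cosh α) * Real.cosh (k * α)) (Ioi (0:ℝ)) := by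
  refine Integrable.mono' ((integrableOn_exp_neg_Ioi 0).const_mul (Real.exp ((|k| + 1) ^ 2 / t)))
    (Continuous.aestronglyMeasurable (by fun_prop)) ?_
  refine (ae_restrict_iff' measurableSet_Ioi).2 (Eventually.of_forall fun α hα => ?_)
  have hα : 0 ≤ α := le_of_lt hα
  rw [Real.norm_of_nonneg (by positivity)]
  refine le_trans ?_ (bessel_exp_bound t k α ht hα)
  exact mul_le_mul_of_nonneg_left (bessel_cosh_le _) (Real.exp_pos _).le

lemma besselK_hasDerivAt (n : ℤ) (t : ℝ) (ht : 0 < t) :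
    HasDerivAt (besselK n) (-(besselK (n + 1) t + besselK (n - 1) t) / 2) t := by
  have hprod : ∀ α : ℝ, Real.cosh α * Real.cosh (n * α) =
      (Real.cosh (((n + 1 : ℤ) : ℝ) * α) + Real.cosh (((n - 1 : ℤ) : ℝ) * α)) / 2 := by
    intro α
    push_cast
    rw [add_mul, sub_mul, one_mul, Real.cosh_add, Real.cosh_sub]; ring
  have hint : ∀ s : ℝ, 0 < s → IntegrableOn
      (fun α => Real.exp (-s * Real.cosh α) * (Real.cosh α * Real.cosh (n * α))) (Ioi (0:ℝ)) := by
    intro s hs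
    have := ((besselK_integrable ((n + 1 : ℤ) : ℝ) s hs).add
      (besselK_integrable ((n - 1 : ℤ) : ℝ) s hs)).div_const 2
    refine this.congr (Eventually.of_forall fun α => ?_)
    simp only [Pi.add_apply, hprod]; ring
  have key := (hasDerivAt_integral_of_dominated_loc_of_deriv_le
    (μ := volume.restrict (Ioi (0:ℝ))) (x₀ := t) (s := Ioi (t / 2))
    (F := fun s α => Real.exp (-s * Real.cosh α) * Real.cosh ((n : ℝ) * α))
    (F' := fun s α => -(Real.exp (-s * Real.cosh α) * (Real.cosh α * Real.cosh (n * α))))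
    (bound := fun α => Real.exp (-(t / 2) * Real.cosh α) * (Real.cosh α * Real.cosh (n * α)))
    (Ioi_mem_nhds (by linarith))
    (Eventually.of_forall fun s => Continuous.aestronglyMeasurable (by fun_prop))
    (besselK_integrable n t ht)
    (Continuous.aestronglyMeasurable (by fun_prop))
    (Eventually.of_forall fun α s hs => by
      have hs : t / 2 < s := hs
      rw [norm_neg, Real.norm_of_nonneg (by positivity)]
      gcongr)
    (hint (t / 2) (by linarith))
    (Eventually.of_forall fun α s hs => by
      have h1 : HasDerivAt (fun s : ℝ => -s * Real.cosh α) (-1 * Real.cosh α) s :=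
        (hasDerivAt_neg s).mul_const _
      refine (h1.exp.mul_const (Real.cosh (n * α))).congr_deriv ?_
      ring)).2
  have e : (-(besselK (n + 1) t + besselK (n - 1) t) / 2) =
      ∫ α in Ioi (0:ℝ), -(Real.exp (-t * Real.cosh α) * (Real.cosh α * Real.cosh (n * α))) := by
    unfold besselK
    rw [← integral_add (besselK_integrable _ t ht) (besselK_integrable _ t ht),
      MeasureTheory.integral_neg, neg_div, ← MeasureTheory.integral_div]
    congr 1
    refine integral_congr_ae (Eventually.of_forall fun α => ?_)
    simp only [hprod]; ring
  rw [e]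
  exact key

lemma besselK_rec (n : ℤ) (t : ℝ) (ht : 0 < t) :
    t * (besselK (n + 1) t - besselK (n - 1) t) = 2 * n * besselK n t := by
  have hprod : ∀ α : ℝ, Real.sinh α * Real.sinh (n * α) =
      (Real.cosh (((n + 1 : ℤ) : ℝ) * α) - Real.cosh (((n - 1 : ℤ) : ℝ) * α)) / 2 := by
    intro α
    push_cast
    rw [add_mul, sub_mul, one_mul, Real.cosh_add, Real.cosh_sub]; ring
  have i1 := besselK_integrable ((n + 1 : ℤ) : ℝ) t ht
  have i2 := besselK_integrable ((n - 1 : ℤ) : ℝ) t ht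
  have i0 := besselK_integrable n t ht
  have hi := (i0.const_mul (2 * (n:ℝ))).sub ((i1.sub i2).const_mul t)
  have hlim : Tendsto (fun α : ℝ => 2 * (Real.exp (-t * Real.cosh α) * Real.sinh (n * α)))
      atTop (𝓝 0) := by
    have h0 : Tendsto (fun α : ℝ => Real.exp ((|(n:ℝ)| + 1) ^ 2 / t) * Real.exp (-α))
        atTop (𝓝 0) := by
      simpa using (Real.tendsto_exp_neg_atTop_nhds_zero).const_mul
        (Real.exp ((|(n:ℝ)| + 1) ^ 2 / t))
    have : Tendsto (fun α : ℝ => Real.exp (-t * Real.cosh α) * Real.sinh (n * α))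
        atTop (𝓝 0) := by
      refine squeeze_zero_norm' ?_ h0
      filter_upwards [eventually_ge_atTop 0] with α hα
      rw [norm_mul, Real.norm_of_nonneg (Real.exp_pos _).le, Real.norm_eq_abs]
      refine le_trans ?_ (bessel_exp_bound t n α ht hα)
      exact mul_le_mul_of_nonneg_left (bessel_abs_sinh_le _) (Real.exp_pos _).le
    simpa using this.const_mul 2
  have := integral_Ioi_of_hasDerivAt_of_tendsto' (a := 0) (m := 0)
    (f := fun α : ℝ => 2 * (Real.exp (-t * Real.cosh α) * Real.sinh (n * α)))
    (fun α _ => by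
      have h1 : HasDerivAt (fun α : ℝ => -t * Real.cosh α) (-t * Real.sinh α) α :=
        (Real.hasDerivAt_cosh α).const_mul _
      have h2 : HasDerivAt (fun α : ℝ => Real.sinh (n * α)) (Real.cosh (n * α) * (n * 1)) α :=
        ((hasDerivAt_id α).const_mul (n:ℝ)).sinh
      refine ((h1.exp.mul h2).const_mul 2).congr_deriv ?_
      have := hprod α
      simp only [Pi.sub_apply]
      linear_combination (-2 * t * Real.exp (-t * Real.cosh α)) * this) hi hlim
  simp only [Pi.sub_apply] at this
  have e := integral_sub (i0.const_mul (2 * (n:ℝ))) ((i1.sub i2).const_mul t)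
  have e2 := integral_sub i1 i2
  simp only [Pi.sub_apply] at e e2
  rw [e, MeasureTheory.integral_const_mul, MeasureTheory.integral_const_mul, e2] at this
  simp only [mul_zero, Real.sinh_zero, sub_zero] at this
  unfold besselK
  linarith

lemma besselK_nonneg (n : ℤ) (t : ℝ) : 0 ≤ besselK n t := by
  unfold besselK
  exact integral_nonneg fun α => by positivity

lemma besselK_mono (n : ℤ) (hn : 0 ≤ n) (t : ℝ) (ht : 0 < t) :
    besselK n t ≤ besselK (n + 1) t := by
  unfold besselK
  refine setIntegral_mono_on (besselK_integrable _ t ht) (besselK_integrable _ t ht)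
    measurableSet_Ioi fun α hα => ?_
  have hα : 0 < α := hα
  have hn' : (0:ℝ) ≤ n := by exact_mod_cast hn
  refine mul_le_mul_of_nonneg_left ?_ (Real.exp_pos _).le
  rw [Real.cosh_le_cosh]
  push_cast
  rw [abs_of_nonneg (by positivity), abs_of_nonneg (by positivity)]
  nlinarith

lemma besselK_one_le (t : ℝ) (ht : 0 < t) : t * besselK 1 t ≤ 1 := by
  have hd : ∀ α ∈ Ici (0:ℝ), HasDerivAt (fun α : ℝ => -Real.exp (-t * Real.sinh α))
      (t * (Real.exp (-t * Real.sinh α) * Real.cosh α)) α := by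
    intro α _
    have h1 : HasDerivAt (fun α : ℝ => -t * Real.sinh α) (-t * Real.cosh α) α :=
      (Real.hasDerivAt_sinh α).const_mul _
    refine h1.exp.neg.congr_deriv ?_
    ring
  have hsinh : Tendsto (fun α : ℝ => t * Real.sinh α) atTop atTop := by
    refine tendsto_atTop_mono' atTop ?_ (tendsto_id.const_mul_atTop ht)
    filter_upwards [eventually_ge_atTop 0] with α hα
    exact mul_le_mul_of_nonneg_left (Real.self_le_sinh_iff.2 hα) ht.le
  have hlim : Tendsto (fun α : ℝ => -Real.exp (-t * Real.sinh α)) atTop (𝓝 0) := by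
    have := (Real.tendsto_exp_neg_atTop_nhds_zero.comp hsinh).neg
    simpa [Function.comp_def] using this
  have hi := integrableOn_Ioi_deriv_of_nonneg' hd (fun α _ => by positivity) hlim
  have he := integral_Ioi_of_hasDerivAt_of_tendsto' hd hi hlim
  simp at he
  rw [← he]
  unfold besselK
  rw [← MeasureTheory.integral_const_mul]
  refine setIntegral_mono_on ((besselK_integrable _ t ht).const_mul t) (by simpa using hi)
    measurableSet_Ioi fun α hα => ?_
  simp only [Int.cast_one, one_mul, neg_mul]
  have := (Real.sinh_lt_cosh α).le
  gcongr

lemma besselI_hasDerivAt (n : ℤ) (t : ℝ) :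
    HasDerivAt (besselI n) ((besselI (n + 1) t + besselI (n - 1) t) / 2) t := by
  have hprod : ∀ α : ℝ, Real.cos α * Real.cos (n * α) =
      (Real.cos (((n + 1 : ℤ) : ℝ) * α) + Real.cos (((n - 1 : ℤ) : ℝ) * α)) / 2 := by
    intro α
    push_cast
    rw [add_mul, sub_mul, one_mul, Real.cos_add, Real.cos_sub]; ring
  have key := (intervalIntegral.hasDerivAt_integral_of_dominated_loc_of_deriv_le
    (μ := volume) (a := 0) (b := Real.pi) (x₀ := t) (s := Metric.ball t 1)
    (F := fun s α => Real.exp (s * Real.cos α) * Real.cos ((n : ℝ) * α))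
    (F' := fun s α => Real.exp (s * Real.cos α) * (Real.cos α * Real.cos (n * α)))
    (bound := fun α => Real.exp (|t| + 1))
    (Metric.ball_mem_nhds t one_pos)
    (Eventually.of_forall fun s => Continuous.aestronglyMeasurable (by fun_prop))
    (Continuous.intervalIntegrable (by fun_prop) _ _)
    (Continuous.aestronglyMeasurable (by fun_prop))
    (Eventually.of_forall fun α _ s hs => by
      have hs : |s - t| < 1 := by simpa [Real.dist_eq] using hs
      have hs2 : |s| ≤ |t| + 1 := by
        have := abs_sub_abs_le_abs_sub s t
        linarith
      have h1 : s * Real.cos α ≤ |t| + 1 := by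
        refine (le_abs_self _).trans ?_
        rw [abs_mul]
        nlinarith [Real.abs_cos_le_one α, abs_nonneg s, abs_nonneg (Real.cos α)]
      rw [norm_mul, norm_mul, Real.norm_of_nonneg (Real.exp_pos _).le, Real.norm_eq_abs,
        Real.norm_eq_abs]
      have h2 : |Real.cos α| * |Real.cos (n * α)| ≤ 1 :=
        mul_le_one₀ (Real.abs_cos_le_one _) (abs_nonneg _) (Real.abs_cos_le_one _)
      calc _ ≤ Real.exp (s * Real.cos α) * 1 :=
            mul_le_mul_of_nonneg_left h2 (Real.exp_pos _).le
        _ ≤ _ := by rw [mul_one]; exact Real.exp_le_exp.2 h1)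
    (Continuous.intervalIntegrable (by fun_prop) _ _)
    (Eventually.of_forall fun α _ s hs => by
      have h1 : HasDerivAt (fun s : ℝ => s * Real.cos α) (1 * Real.cos α) s :=
        (hasDerivAt_id s).mul_const _
      refine (h1.exp.mul_const (Real.cos (n * α))).congr_deriv ?_
      ring)).2
  have e : ((besselI (n + 1) t + besselI (n - 1) t) / 2) = (1 / Real.pi) *
      ∫ α in (0:ℝ)..Real.pi, Real.exp (t * Real.cos α) * (Real.cos α * Real.cos (n * α)) := by
    unfold besselI
    rw [← mul_add, ← intervalIntegral.integral_add
      (Continuous.intervalIntegrable (by fun_prop) _ _)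
      (Continuous.intervalIntegrable (by fun_prop) _ _), mul_div_assoc,
      ← intervalIntegral.integral_div]
    congr 1
    refine intervalIntegral.integral_congr fun α _ => ?_
    simp only [hprod]; ring
  rw [e]
  exact key.const_mul _

lemma besselI_rec (n : ℤ) (t : ℝ) :
    t * (besselI (n - 1) t - besselI (n + 1) t) = 2 * n * besselI n t := by
  have hprod : ∀ α : ℝ, Real.sin α * Real.sin (n * α) =
      (Real.cos (((n - 1 : ℤ) : ℝ) * α) - Real.cos (((n + 1 : ℤ) : ℝ) * α)) / 2 := by
    intro α
    push_cast
    rw [add_mul, sub_mul, one_mul, Real.cos_add, Real.cos_sub]; ring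
  have ii : ∀ k : ℤ, IntervalIntegrable
      (fun α => Real.exp (t * Real.cos α) * Real.cos ((k : ℝ) * α)) volume 0 Real.pi :=
    fun k => Continuous.intervalIntegrable (by fun_prop) _ _
  have := intervalIntegral.integral_eq_sub_of_hasDerivAt (a := 0) (b := Real.pi)
    (f := fun α : ℝ => 2 * (Real.exp (t * Real.cos α) * Real.sin (n * α)))
    (f' := fun α : ℝ => 2 * n * (Real.exp (t * Real.cos α) * Real.cos ((n : ℝ) * α)) -
      t * (Real.exp (t * Real.cos α) * Real.cos (((n - 1 : ℤ) : ℝ) * α)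
        - Real.exp (t * Real.cos α) * Real.cos (((n + 1 : ℤ) : ℝ) * α)))
    (fun α _ => by
      have h1 : HasDerivAt (fun α : ℝ => t * Real.cos α) (t * -Real.sin α) α :=
        (Real.hasDerivAt_cos α).const_mul _
      have h2 : HasDerivAt (fun α : ℝ => Real.sin (n * α)) (Real.cos (n * α) * (n * 1)) α :=
        ((hasDerivAt_id α).const_mul (n:ℝ)).sin
      refine ((h1.exp.mul h2).const_mul 2).congr_deriv ?_
      have := hprod α
      linear_combination (-2 * t * Real.exp (t * Real.cos α)) * this)
    (Continuous.intervalIntegrable (by fun_prop) _ _)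
  rw [intervalIntegral.integral_sub ((ii n).const_mul _) (((ii _).sub (ii _)).const_mul t),
    intervalIntegral.integral_const_mul, intervalIntegral.integral_const_mul,
    intervalIntegral.integral_sub (ii _) (ii _), Real.sin_int_mul_pi] at this
  simp only [mul_zero, Real.sin_zero, sub_zero] at this
  unfold besselI
  linear_combination (-(1 / Real.pi)) * this

lemma besselI_nonneg (n : ℕ) : ∀ t : ℝ, 0 ≤ t → 0 ≤ besselI n t := by
  induction n with
  | zero =>
    intro t _
    unfold besselI
    refine mul_nonneg (by positivity) ?_
    refine intervalIntegral.integral_nonneg Real.pi_pos.le fun α _ => ?_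
    simp only [Nat.cast_zero, Int.cast_zero, zero_mul, Real.cos_zero, mul_one]
    positivity
  | succ n ih =>
    have hd : ∀ t : ℝ, HasDerivAt (fun t => t ^ (n + 1) * besselI ((n:ℤ) + 1) t)
        (t ^ (n + 1) * besselI n t) t := by
      intro t
      refine ((hasDerivAt_pow (n + 1) t).mul (besselI_hasDerivAt ((n:ℤ) + 1) t)).congr_deriv ?_
      have h := besselI_rec ((n:ℤ) + 1) t
      rw [show (n:ℤ) + 1 - 1 = n by ring] at h ⊢
      push_cast at h ⊢
      linear_combination (-(t ^ n) / 2) * h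
    have hm : MonotoneOn (fun t => t ^ (n + 1) * besselI ((n:ℤ) + 1) t) (Ici (0:ℝ)) := by
      refine monotoneOn_of_deriv_nonneg (convex_Ici 0)
        (fun t _ => (hd t).continuousAt.continuousWithinAt)
        (fun t _ => (hd t).differentiableAt.differentiableWithinAt) fun t ht => ?_
      rw [interior_Ici] at ht
      rw [(hd t).deriv]
      have ht : 0 < t := ht
      exact mul_nonneg (by positivity) (ih t ht.le)
    intro t ht
    push_cast
    rcases ht.eq_or_lt with rfl | ht
    · have h := besselI_rec ((n:ℤ) + 1) 0
      rw [zero_mul] at h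
      have hne : (2 * (((n:ℤ) + 1 : ℤ) : ℝ)) ≠ 0 := by push_cast; positivity
      rcases mul_eq_zero.1 h.symm with h | h
      · exact absurd h hne
      · exact h.ge
    · have := hm self_mem_Ici ht.le ht.le
      simp only [ne_eq, Nat.add_eq_zero_iff, one_ne_zero, and_false, not_false_eq_true, zero_pow,
        zero_mul] at this
      exact nonneg_of_mul_nonneg_right this (by positivity)

lemma bessel_wronskian_zero (t : ℝ) (ht : 0 < t) :
    t * (besselI 0 t * besselK 1 t + besselI 1 t * besselK 0 t) ≤ 1 := by
  set W : ℝ → ℝ := fun t => t * (besselI 0 t * besselK 1 t + besselI 1 t * besselK 0 t) with hW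
  have hd : ∀ s ∈ Ioi (0:ℝ), HasDerivAt W 0 s := by
    intro s hs
    have hs : 0 < s := hs
    have a := besselI_hasDerivAt 0 s
    have b := besselI_hasDerivAt 1 s
    have c := besselK_hasDerivAt 0 s hs
    have d := besselK_hasDerivAt 1 s hs
    refine ((hasDerivAt_id s).mul ((a.mul d).add (b.mul c))).congr_deriv ?_
    have r0 := besselI_rec 0 s
    have r1 := besselI_rec 1 s
    have q0 := besselK_rec 0 s hs
    have q1 := besselK_rec 1 s hs
    norm_num at r0 r1 q0 q1 ⊢
    have r0 : besselI (-1) s = besselI 1 s := by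
      rcases r0 with h | h <;> linarith
    have q0 : besselK (-1) s = besselK 1 s := by
      rcases q0 with h | h <;> linarith
    rw [r0, q0]
    linear_combination (-(besselK 0 s) / 2) * r1 - (besselI 0 s / 2) * q1
  have hc : ∀ s ∈ Ioi (0:ℝ), W t = W s := fun s hs =>
    isOpen_Ioi.is_const_of_deriv_eq_zero isPreconnected_Ioi
      (fun x hx => (hd x hx).differentiableAt.differentiableWithinAt)
      (fun x hx => (hd x hx).deriv) ht hs
  have hb : ∀ s ∈ Ioi (0:ℝ), W t ≤ besselI 0 s + besselI 1 s := by
    intro s hs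
    rw [hc s hs]
    have hs : 0 < s := hs
    have k1 := besselK_one_le s hs
    have k0 : s * besselK 0 s ≤ 1 :=
      (mul_le_mul_of_nonneg_left (by simpa using besselK_mono 0 le_rfl s hs) hs.le).trans k1
    have i0 : 0 ≤ besselI 0 s := by simpa using besselI_nonneg 0 s hs.le
    have i1 : 0 ≤ besselI 1 s := by simpa using besselI_nonneg 1 s hs.le
    simp only [hW]
    nlinarith [mul_le_mul_of_nonneg_left k1 i0, mul_le_mul_of_nonneg_left k0 i1]
  have v0 : besselI 0 0 = 1 := by
    simp [besselI, Real.pi_ne_zero]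
  have v1 : besselI 1 0 = 0 := by
    simp [besselI]
  have hl : Tendsto (fun s => besselI 0 s + besselI 1 s) (𝓝[>] 0) (𝓝 1) := by
    have : ContinuousAt (fun s => besselI 0 s + besselI 1 s) 0 :=
      (besselI_hasDerivAt 0 0).continuousAt.add (besselI_hasDerivAt 1 0).continuousAt
    have h := this.tendsto
    rw [v0, v1, add_zero] at h
    exact h.mono_left nhdsWithin_le_nhds
  exact ge_of_tendsto hl (eventually_mem_nhdsWithin.mono hb)

lemma bessel_wronskian (n : ℕ) (t : ℝ) (ht : 0 < t) :
    t * (besselI n t * besselK (n + 1) t + besselI (n + 1) t * besselK n t) ≤ 1 := by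
  induction n with
  | zero => simpa using bessel_wronskian_zero t ht
  | succ n ih =>
    refine le_trans (le_of_eq ?_) ih
    have r := besselI_rec ((n:ℤ) + 1) t
    have q := besselK_rec ((n:ℤ) + 1) t ht
    rw [show (n:ℤ) + 1 - 1 = n by ring] at r q
    push_cast
    linear_combination (besselI (n + 1) t) * q - (besselK (n + 1) t) * r

/-- `t·K_n(t)·I_n(t) ≤ t·K_{n+1}(t)·I_n(t) ≤ 1` for `n ≥ 0` and `t > 0`. -/
theorem mul_besselK_mul_besselI_le_one (n : ℤ) (hn : 0 ≤ n) (t : ℝ) (ht : 0 < t) :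
    t * besselK n t * besselI n t ≤ t * besselK (n + 1) t * besselI n t ∧
    t * besselK (n + 1) t * besselI n t ≤ 1 := by
  obtain ⟨m, rfl⟩ := Int.eq_ofNat_of_zero_le hn
  have i0 := besselI_nonneg m t ht.le
  have i1 := besselI_nonneg (m + 1) t ht.le
  push_cast at i1
  have hw := bessel_wronskian m t ht
  have k0 := besselK_nonneg m t
  constructor
  · exact mul_le_mul_of_nonneg_right
      (mul_le_mul_of_nonneg_left (besselK_mono m hn t ht) ht.le) i0
  · have := mul_nonneg ht.le (mul_nonneg i1 k0)
    linarith
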